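/- There is an absolute constant C₀ ≥ 1 such that the following holds. Let n, m ≥ 1, let p ≥ 2 be even, let q be an integer with 1 ≤ q ≤ p−1, let 0 < ε ≤ 1 and C > 0, let μ be a finitely supported probability measure on ℝ^n × ℝ^m with a finite mixture presentation (λ_t, μ'_t)_{t ≤ N} in which every μ'_t satisfies ∑_i 𝔼_{μ'_t}[u_i^p] = ∑_i 𝔼_μ[u_i^p] and ∑_j 𝔼_{μ'_t}[v_j^p] = ∑_j 𝔼_μ[v_j^p]; define truncations ũ_i, ṽ_j from μ and C, and let A : Fin n → Fin m → ℝ. Assume ∑_t λ_t · ∑_i (∑_j (A i j)^p) · (∑_j TV(law_{μ'_t}(ũ_i, ṽ_j), law_{μ'_t}(ũ_i) ⊗ law_{μ'_t}(ṽ_j))^{p/(p−q)} · 𝔼_μ[v_j^p])^{(p−q)/q} ≤ ε · (∑_{i,j}(A i j)^p)^{(p+q)/(2q)}. Then |∑_t λ_t · (∑_{i,j} 𝔼_{μ'_t}[(A i j)^q (u_i v_j)^{p−q}] − ∑_{i,j} 𝔼_{(μ'_t)^⊗}[(A i j)^q (u_i v_j)^{p−q}])| ≤ C₀·( C^{2(p−q)}·ε^{q/p}·(∑_i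 𝔼_μ[u_i^p])^{(p−q)/p}·(∑_{i,j}(A i j)^p)^{(p+q)/(2p)} + (1/C^q)·(∑_{i,j}(A i j)^p)^{q/p}·[ (∑_{i,j}𝔼_μ[(u_i v_j)^p])^{(p−q)/p} + ((∑_i 𝔼_μ[u_i^p])·(∑_j 𝔼_μ[v_j^p]))^{(p−q)/p} ] ). -/

import Mathlib

open Finset
open scoped Classical

/-- A finitely supported probability measure on `X`, given by a finite support
and a mass function. -/
structure FinDist (X : Type*) where
  supp : Finset X
  mass : X → ℝ
  nonneg : ∀ x, 0 ≤ mass x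
  zero_out : ∀ x ∉ supp, mass x = 0
  total : ∑ x ∈ supp, mass x = 1

/-- Expectation of a real-valued function. -/
noncomputable def FinDist.exp {X : Type*} (μ : FinDist X) (f : X → ℝ) : ℝ :=
  ∑ x ∈ μ.supp, μ.mass x * f x

/-- Expectation, under the product of the single-coordinate marginals `ν^⊗`,
of a function `F (g x) (h y)` of two distinct coordinates `g` and `h`
(two distinct coordinates are independent under `ν^⊗`). -/
noncomputable def prodExp2 {X : Type*} (ν : FinDist X) (g h : X → ℝ)
    (F : ℝ → ℝ → ℝ) : ℝ :=
  ∑ x ∈ ν.supp, ∑ y ∈ ν.supp, ν.mass x * ν.mass y * F (g x) (h y)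

/-- Total variation distance between the joint law of `(g, h)` under `ν` and
the product of the laws of `g` and `h` under `ν`. -/
noncomputable def tvJoint {X : Type*} {E : Type*} (ν : FinDist X) (g h : X → E) : ℝ :=
  (1 / 2) * ∑ ab ∈ (ν.supp.image g) ×ˢ (ν.supp.image h),
    |(∑ x ∈ ν.supp.filter (fun x => g x = ab.1 ∧ h x = ab.2), ν.mass x)
      - (∑ x ∈ ν.supp.filter (fun x => g x = ab.1), ν.mass x)
        * (∑ x ∈ ν.supp.filter (fun x => h x = ab.2), ν.mass x)|

/-- Truncation of a real value at threshold `thr`: keep it if `|a| ≤ thr`, else `0`. -/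
noncomputable def truncVal (thr a : ℝ) : ℝ := if |a| ≤ thr then a else 0

/-- The truncation threshold `C·(𝔼_μ[u_i^p])^{1/p}` for the coordinate `u_i`. -/
noncomputable def thrU {n m : ℕ} (μ : FinDist ((Fin n → ℝ) × (Fin m → ℝ)))
    (C : ℝ) (p : ℕ) (i : Fin n) : ℝ :=
  C * (μ.exp (fun x => x.1 i ^ p)) ^ ((1 : ℝ) / (p : ℝ))

/-- The truncation threshold `C·(𝔼_μ[v_j^p])^{1/p}` for the coordinate `v_j`. -/
noncomputable def thrV {n m : ℕ} (μ : FinDist ((Fin n → ℝ) × (Fin m → ℝ)))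
    (C : ℝ) (p : ℕ) (j : Fin m) : ℝ :=
  C * (μ.exp (fun x => x.2 j ^ p)) ^ ((1 : ℝ) / (p : ℝ))

/-- Hölder-type bound. -/
def HB (θ φ Z X Y : ℝ) : Prop := 0 ≤ X ∧ 0 ≤ Y ∧ Z ≤ X ^ θ * Y ^ φ

lemma HB.sum {ι : Type*} (s : Finset ι) {θ φ : ℝ} (hθ : 0 < θ) (hφ : 0 < φ) (h1 : θ + φ = 1)
    {Z X Y : ι → ℝ} (h : ∀ i ∈ s, HB θ φ (Z i) (X i) (Y i)) :
    HB θ φ (∑ i ∈ s, Z i) (∑ i ∈ s, X i) (∑ i ∈ s, Y i) := by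
  refine ⟨Finset.sum_nonneg fun i hi => (h i hi).1, Finset.sum_nonneg fun i hi => (h i hi).2.1, ?_⟩
  have hc : (θ⁻¹).HolderConjugate φ⁻¹ := by
    rw [Real.holderConjugate_iff]
    refine ⟨?_, by simpa using h1⟩
    exact (one_lt_inv₀ hθ).2 (by linarith)
  have := Real.inner_le_Lp_mul_Lq_of_nonneg s hc (f := fun i => X i ^ θ) (g := fun i => Y i ^ φ)
    (fun i hi => Real.rpow_nonneg (h i hi).1 _) (fun i hi => Real.rpow_nonneg (h i hi).2.1 _)
  refine (Finset.sum_le_sum fun i hi => (h i hi).2.2).trans (this.trans (le_of_eq ?_))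
  have e1 : ∑ i ∈ s, (X i ^ θ) ^ θ⁻¹ = ∑ i ∈ s, X i :=
    Finset.sum_congr rfl fun i hi => Real.rpow_rpow_inv (h i hi).1 hθ.ne'
  have e2 : ∑ i ∈ s, (Y i ^ φ) ^ φ⁻¹ = ∑ i ∈ s, Y i :=
    Finset.sum_congr rfl fun i hi => Real.rpow_rpow_inv (h i hi).2.1 hφ.ne'
  rw [e1, e2]; simp

lemma HB.smul {θ φ : ℝ} (h1 : θ + φ = 1) {c Z X Y : ℝ} (hc : 0 ≤ c) (h : HB θ φ Z X Y) :
    HB θ φ (c * Z) (c * X) (c * Y) := by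
  obtain ⟨hx, hy, hz⟩ := h
  refine ⟨mul_nonneg hc hx, mul_nonneg hc hy, ?_⟩
  rw [Real.mul_rpow hc hx, Real.mul_rpow hc hy]
  have : c = c ^ θ * c ^ φ := by
    rw [← Real.rpow_add' hc (by rw [h1]; exact one_ne_zero), h1, Real.rpow_one]
  calc c * Z ≤ c * (X ^ θ * Y ^ φ) := mul_le_mul_of_nonneg_left hz hc
    _ = (c ^ θ * c ^ φ) * (X ^ θ * Y ^ φ) := by rw [← this]
    _ = _ := by ring

lemma HB.mono {θ φ Z X Y Z' : ℝ} (h : HB θ φ Z X Y) (hz : Z' ≤ Z) : HB θ φ Z' X Y :=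
  ⟨h.1, h.2.1, hz.trans h.2.2⟩

lemma HB.exp {Ω : Type*} (ν : FinDist Ω) {θ φ : ℝ} (hθ : 0 < θ) (hφ : 0 < φ) (h1 : θ + φ = 1)
    {Z X Y : Ω → ℝ} (h : ∀ i, HB θ φ (Z i) (X i) (Y i)) :
    HB θ φ (ν.exp Z) (ν.exp X) (ν.exp Y) :=
  HB.sum _ hθ hφ h1 fun i _ => (h i).smul h1 (ν.nonneg i)

lemma prodExp2_eq {Ω : Type*} (ν : FinDist Ω) (g h : Ω → ℝ) (F : ℝ → ℝ → ℝ) :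
    prodExp2 ν g h F = ν.exp fun x => ν.exp fun y => F (g x) (h y) := by
  simp only [prodExp2, FinDist.exp, Finset.mul_sum, mul_assoc]

lemma exp_mono {Ω : Type*} (ν : FinDist Ω) {f g : Ω → ℝ} (h : ∀ x, f x ≤ g x) :
    ν.exp f ≤ ν.exp g :=
  Finset.sum_le_sum fun i _ => mul_le_mul_of_nonneg_left (h i) (ν.nonneg i)

lemma exp_nonneg' {Ω : Type*} (ν : FinDist Ω) {f : Ω → ℝ} (h : ∀ x, 0 ≤ f x) :
    0 ≤ ν.exp f :=
  Finset.sum_nonneg fun i _ => mul_nonneg (ν.nonneg i) (h i)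

lemma exp_add {Ω : Type*} (ν : FinDist Ω) (f g : Ω → ℝ) :
    ν.exp (fun x => f x + g x) = ν.exp f + ν.exp g := by
  simp only [FinDist.exp, mul_add, Finset.sum_add_distrib]

lemma exp_sub {Ω : Type*} (ν : FinDist Ω) (f g : Ω → ℝ) :
    ν.exp (fun x => f x - g x) = ν.exp f - ν.exp g := by
  simp only [FinDist.exp, mul_sub, Finset.sum_sub_distrib]

lemma exp_cmul {Ω : Type*} (ν : FinDist Ω) (c : ℝ) (f : Ω → ℝ) :
    ν.exp (fun x => c * f x) = c * ν.exp f := by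
  simp only [FinDist.exp, Finset.mul_sum]; exact Finset.sum_congr rfl fun _ _ => by ring

lemma exp_mulc {Ω : Type*} (ν : FinDist Ω) (c : ℝ) (f : Ω → ℝ) :
    ν.exp (fun x => f x * c) = ν.exp f * c := by
  simp only [FinDist.exp, Finset.sum_mul]; exact Finset.sum_congr rfl fun _ _ => by ring

lemma exp_const {Ω : Type*} (ν : FinDist Ω) (c : ℝ) :
    ν.exp (fun _ => c) = c := by
  simp only [FinDist.exp, ← Finset.sum_mul, ν.total, one_mul]

lemma exp_abs {Ω : Type*} (ν : FinDist Ω) (f : Ω → ℝ) :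
    |ν.exp f| ≤ ν.exp fun x => |f x| := by
  refine (Finset.abs_sum_le_sum_abs _ _).trans (le_of_eq ?_)
  refine Finset.sum_congr rfl fun i _ => ?_
  rw [abs_mul, abs_of_nonneg (ν.nonneg i)]

lemma tv_bound {Ω : Type*} (ν : FinDist Ω) (g h : Ω → ℝ) (F : ℝ → ℝ → ℝ) (B : ℝ)
    (hB : ∀ x y, |F (g x) (h y)| ≤ B) :
    |ν.exp (fun x => F (g x) (h x)) - prodExp2 ν g h F| ≤ 2 * tvJoint ν g h * B := by
  have key1 : ν.exp (fun x => F (g x) (h x)) =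
      ∑ ab ∈ (ν.supp.image g) ×ˢ (ν.supp.image h),
        (∑ x ∈ ν.supp.filter (fun x => g x = ab.1 ∧ h x = ab.2), ν.mass x) * F ab.1 ab.2 := by
    rw [FinDist.exp, ← Finset.sum_fiberwise_of_maps_to (g := fun x => (g x, h x))
      (t := (ν.supp.image g) ×ˢ (ν.supp.image h))]
    · refine Finset.sum_congr rfl fun ab _ => ?_
      rw [Finset.sum_mul]
      refine Finset.sum_congr ?_ ?_
      · ext x; simp [Prod.ext_iff]
      · intro x hx
        simp only [Finset.mem_filter] at hx
        rw [hx.2.1, hx.2.2]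
    · intro x hx
      simp only [Finset.mem_product]
      exact ⟨Finset.mem_image_of_mem _ hx, Finset.mem_image_of_mem _ hx⟩
  have mar : ∀ (k : Ω → ℝ) (G : ℝ → ℝ), ν.exp (fun x => G (k x)) =
      ∑ a ∈ ν.supp.image k, (∑ x ∈ ν.supp.filter (fun x => k x = a), ν.mass x) * G a := by
    intro k G
    rw [FinDist.exp, ← Finset.sum_fiberwise_of_maps_to (g := k)
      (t := ν.supp.image k) (fun x hx => Finset.mem_image_of_mem _ hx)]
    refine Finset.sum_congr rfl fun a _ => ?_
    rw [Finset.sum_mul]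
    refine Finset.sum_congr rfl fun x hx => ?_
    rw [(Finset.mem_filter.1 hx).2]
  have key2 : prodExp2 ν g h F =
      ∑ ab ∈ (ν.supp.image g) ×ˢ (ν.supp.image h),
        ((∑ x ∈ ν.supp.filter (fun x => g x = ab.1), ν.mass x)
        * (∑ x ∈ ν.supp.filter (fun x => h x = ab.2), ν.mass x)) * F ab.1 ab.2 := by
    rw [prodExp2_eq, mar g (fun a => ν.exp fun y => F a (h y)), Finset.sum_product]
    refine Finset.sum_congr rfl fun a _ => ?_
    rw [mar h (F a), Finset.mul_sum]
    exact Finset.sum_congr rfl fun b _ => by ring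
  rw [key1, key2, ← Finset.sum_sub_distrib, tvJoint]
  rw [show ∀ s : ℝ, 2 * (1 / 2 * s) * B = s * B from fun s => by ring, Finset.sum_mul]
  refine (Finset.abs_sum_le_sum_abs _ _).trans (Finset.sum_le_sum ?_)
  rintro ⟨a, b⟩ hab
  rw [← sub_mul, abs_mul]
  refine mul_le_mul_of_nonneg_left ?_ (abs_nonneg _)
  simp only [Finset.mem_product, Finset.mem_image] at hab
  obtain ⟨⟨x, _, rfl⟩, ⟨y, _, rfl⟩⟩ := hab
  exact hB x y

/-- indicator of exceeding the threshold -/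
noncomputable def bdI (thr a : ℝ) : ℝ := if |a| ≤ thr then 0 else 1

lemma bdI_nonneg (thr a : ℝ) : 0 ≤ bdI thr a := by unfold bdI; split_ifs <;> norm_num

lemma markov {Ω : Type*} (ν : FinDist Ω) (f : Ω → ℝ) (C : ℝ) (hC : 0 < C) (p : ℕ) (hp : p ≠ 0)
    (hev : Even p) :
    ν.exp (fun x => bdI (C * (ν.exp fun x => f x ^ p) ^ ((1 : ℝ) / (p : ℝ))) (f x)) ≤ 1 / C ^ p := by
  have h0 : 0 ≤ ν.exp fun x => f x ^ p := exp_nonneg' ν fun x => hev.pow_nonneg _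
  set U := ν.exp fun x => f x ^ p with hU
  rcases h0.eq_or_lt with h | h
  · have : ν.exp (fun x => bdI (C * U ^ ((1 : ℝ) / (p : ℝ))) (f x)) = 0 := by
      rw [← h, Real.zero_rpow (by positivity), mul_zero]
      refine Finset.sum_eq_zero fun x hx => ?_
      have h2 := (Finset.sum_eq_zero_iff_of_nonneg
        (fun x _ => mul_nonneg (ν.nonneg x) (hev.pow_nonneg (f x)))).1 h.symm x hx
      rcases mul_eq_zero.1 h2 with h3 | h3
      · rw [h3, zero_mul]
      · rw [pow_eq_zero_iff hp] at h3
        simp [bdI, h3]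
    rw [this]; positivity
  · rw [le_div_iff₀ (by positivity)]
    have : ν.exp (fun x => bdI (C * U ^ ((1 : ℝ) / (p : ℝ))) (f x) * (C ^ p * U)) ≤ U := by
      refine exp_mono ν fun x => ?_
      unfold bdI
      split_ifs with hh
      · rw [zero_mul]; exact hev.pow_nonneg _
      · push Not at hh
        rw [one_mul, ← hev.pow_abs (f x)]
        refine le_trans (le_of_eq ?_) (pow_le_pow_left₀ (by positivity) hh.le p)
        rw [mul_pow, one_div, Real.rpow_inv_natCast_pow h.le hp]
    rw [exp_mulc] at this
    nlinarith

lemma even_rpow {p q : ℕ} (hp : p ≠ 0) (hev : Even p) (a : ℝ) :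
    (a ^ p) ^ ((q : ℝ) / p) = |a| ^ q := by
  rw [← hev.pow_abs a, ← Real.rpow_natCast, ← Real.rpow_mul (abs_nonneg a),
    mul_div_cancel₀ _ (by exact_mod_cast hp), Real.rpow_natCast]

lemma tail_pt {p q k : ℕ} (hp : p ≠ 0) (hev : Even p) (hk : k ≠ 0) (A s r a b : ℝ) :
    HB ((q : ℝ) / p) ((k : ℝ) / p)
      |A ^ q * (a * b) ^ k - A ^ q * (truncVal s a * truncVal r b) ^ k|
      (A ^ p * (bdI s a + bdI r b)) ((a * b) ^ p) := by
  refine ⟨mul_nonneg (hev.pow_nonneg _) (add_nonneg (bdI_nonneg _ _) (bdI_nonneg _ _)),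
    hev.pow_nonneg _, ?_⟩
  rw [Real.mul_rpow (hev.pow_nonneg _) (add_nonneg (bdI_nonneg _ _) (bdI_nonneg _ _)),
    even_rpow hp hev, even_rpow hp hev, ← mul_sub, abs_mul, abs_pow, mul_assoc]
  refine mul_le_mul_of_nonneg_left ?_ (by positivity)
  by_cases hg : |a| ≤ s ∧ |b| ≤ r
  · simp only [truncVal, hg.1, hg.2, if_true, sub_self, abs_zero]
    have : 0 ≤ bdI s a + bdI r b := add_nonneg (bdI_nonneg _ _) (bdI_nonneg _ _)
    positivity
  · have h1 : truncVal s a * truncVal r b = 0 := by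
      unfold truncVal
      by_cases h : |a| ≤ s
      · have : ¬ |b| ≤ r := fun h' => hg ⟨h, h'⟩
        simp [this]
      · simp [h]
    have h2 : 1 ≤ bdI s a + bdI r b := by
      unfold bdI
      by_cases h : |a| ≤ s
      · have : ¬ |b| ≤ r := fun h' => hg ⟨h, h'⟩
        simp [this, h]
      · rw [if_neg h]; split_ifs <;> norm_num
    rw [h1, zero_pow hk, sub_zero, abs_pow]
    exact le_mul_of_one_le_left (by positivity) (Real.one_le_rpow h2 (by positivity))

lemma trunc_pt {s a : ℝ} (hs : 0 ≤ s) : |truncVal s a| ≤ s := by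
  unfold truncVal; split_ifs with h
  · exact h
  · simpa using hs

lemma tv_nonneg {Ω : Type*} (ν : FinDist Ω) (g h : Ω → ℝ) : 0 ≤ tvJoint ν g h := by
  unfold tvJoint
  exact mul_nonneg (by norm_num) (Finset.sum_nonneg fun _ _ => abs_nonneg _)

lemma const_bound {C S : ℝ} {p q : ℕ} (hp : p ≠ 0) (hq : q ≤ p) (hC : 0 < C) (hS : 0 ≤ S) {X : ℝ}
    (hX0 : 0 ≤ X) (hX : X ≤ S * (2 / C ^ p)) :
    X ^ ((q : ℝ) / p) ≤ 2 * (1 / C ^ q * S ^ ((q : ℝ) / p)) := by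
  refine (Real.rpow_le_rpow hX0 hX (by positivity)).trans ?_
  rw [Real.mul_rpow hS (by positivity), Real.div_rpow (by norm_num) (by positivity)]
  have e : (C ^ p) ^ ((q : ℝ) / p) = C ^ q := by
    rw [← Real.rpow_natCast, ← Real.rpow_mul hC.le,
      mul_div_cancel₀ _ (by exact_mod_cast hp), Real.rpow_natCast]
  rw [e]
  have h2 : (2 : ℝ) ^ ((q : ℝ) / p) ≤ 2 := by
    have : (q : ℝ) / p ≤ 1 := div_le_one_of_le₀ (by exact_mod_cast hq) (by positivity)
    simpa using Real.rpow_le_rpow_of_exponent_le (by norm_num : (1 : ℝ) ≤ 2) this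
  calc S ^ ((q : ℝ) / p) * (2 ^ ((q : ℝ) / p) / C ^ q)
      ≤ S ^ ((q : ℝ) / p) * (2 / C ^ q) := by gcongr
    _ = _ := by ring

lemma T1 {n m N p q k : ℕ} (hq : 0 < q) (hk : 0 < k) (hpqk : p = q + k) (hev : Even p)
    {ε : ℝ} (hε : 0 < ε) (lam : Fin N → ℝ) (hl : ∀ t, 0 ≤ lam t) (hl1 : ∑ t, lam t = 1)
    (A : Fin n → Fin m → ℝ) (tv : Fin N → Fin n → Fin m → ℝ) (htv : ∀ t i j, 0 ≤ tv t i j)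
    (U : Fin n → ℝ) (V : Fin m → ℝ) (hU : ∀ i, 0 ≤ U i) (hV : ∀ j, 0 ≤ V j)
    (h : ∑ t, lam t * ∑ i, (∑ j, A i j ^ p) *
            (∑ j, tv t i j ^ ((p : ℝ) / (k : ℝ)) * V j) ^ ((k : ℝ) / (q : ℝ))
          ≤ ε * (∑ i, ∑ j, A i j ^ p) ^ (((p : ℝ) + (q : ℝ)) / (2 * (q : ℝ)))) :
    ∑ t, lam t * ∑ i, ∑ j, |A i j| ^ q * (tv t i j * (U i ^ ((k : ℝ) / p) * V j ^ ((k : ℝ) / p)))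
      ≤ ε ^ ((q : ℝ) / p) * (∑ i, U i) ^ ((k : ℝ) / p) *
        (∑ i, ∑ j, A i j ^ p) ^ (((p : ℝ) + (q : ℝ)) / (2 * (p : ℝ))) := by
  have hp : 0 < p := by omega
  have hq' : (0 : ℝ) < q := by exact_mod_cast hq
  have hk' : (0 : ℝ) < k := by exact_mod_cast hk
  have hp' : (0 : ℝ) < p := by exact_mod_cast hp
  have hθ : (0 : ℝ) < (q : ℝ) / p := by positivity
  have hφ : (0 : ℝ) < (k : ℝ) / p := by positivity
  have h1 : (q : ℝ) / p + (k : ℝ) / p = 1 := by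
    rw [← add_div, hpqk]; push_cast; rw [div_self]; positivity
  have hS : 0 ≤ ∑ i, ∑ j, A i j ^ p :=
    Finset.sum_nonneg fun i _ => Finset.sum_nonneg fun j _ => hev.pow_nonneg _
  have main : HB ((q : ℝ) / p) ((k : ℝ) / p)
      (∑ t, lam t * ∑ i, ∑ j,
        |A i j| ^ q * (tv t i j * (U i ^ ((k : ℝ) / p) * V j ^ ((k : ℝ) / p))))
      (∑ t, lam t * ∑ i, (∑ j, A i j ^ p) *
            (∑ j, tv t i j ^ ((p : ℝ) / (k : ℝ)) * V j) ^ ((k : ℝ) / (q : ℝ)))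
      (∑ t, lam t * ∑ i, U i) := by
    refine HB.sum _ hθ hφ h1 fun t _ => HB.smul h1 (hl t) <| HB.sum _ hθ hφ h1 fun i _ => ?_
    have inner : HB ((q : ℝ) / p) ((k : ℝ) / p)
        (∑ j, |A i j| ^ q * (tv t i j * V j ^ ((k : ℝ) / p)))
        (∑ j, A i j ^ p) (∑ j, tv t i j ^ ((p : ℝ) / (k : ℝ)) * V j) := by
      refine HB.sum _ hθ hφ h1 fun j _ => ⟨hev.pow_nonneg _,
        mul_nonneg (Real.rpow_nonneg (htv t i j) _) (hV j), le_of_eq ?_⟩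
      rw [even_rpow hp.ne' hev, Real.mul_rpow (Real.rpow_nonneg (htv t i j) _) (hV j),
        ← Real.rpow_mul (htv t i j), show (p : ℝ) / k * (k / p) = 1 by field_simp, Real.rpow_one]
    obtain ⟨a1, a2, a3⟩ := inner
    refine ⟨mul_nonneg a1 (Real.rpow_nonneg a2 _), hU i, ?_⟩
    rw [Real.mul_rpow a1 (Real.rpow_nonneg a2 _), ← Real.rpow_mul a2,
      show (k : ℝ) / q * (q / p) = k / p by field_simp]
    calc _ = (∑ j, |A i j| ^ q * (tv t i j * V j ^ ((k : ℝ) / p))) * U i ^ ((k : ℝ) / p) := by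
          rw [Finset.sum_mul]; exact Finset.sum_congr rfl fun j _ => by ring
      _ ≤ _ := mul_le_mul_of_nonneg_right a3 (Real.rpow_nonneg (hU i) _)
  obtain ⟨a1, a2, a3⟩ := main
  rw [← Finset.sum_mul, hl1, one_mul] at a3
  refine a3.trans ?_
  have b := Real.rpow_le_rpow a1 h hθ.le
  rw [Real.mul_rpow hε.le (Real.rpow_nonneg hS _), ← Real.rpow_mul hS,
    show ((p : ℝ) + q) / (2 * q) * (q / p) = (p + q) / (2 * p) by field_simp] at b
  refine (mul_le_mul_of_nonneg_right b (Real.rpow_nonneg (Finset.sum_nonneg fun i _ => hU i) _)).trans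
    (le_of_eq (by ring))

lemma bad_bound {n m p : ℕ} (hp : p ≠ 0) (hev : Even p) {C : ℝ} (hC : 0 < C)
    (μ : FinDist ((Fin n → ℝ) × (Fin m → ℝ))) (i : Fin n) (j : Fin m) :
    μ.exp (fun x => bdI (thrU μ C p i) (x.1 i)) + μ.exp (fun x => bdI (thrV μ C p j) (x.2 j))
      ≤ 2 / C ^ p := by
  have h1 := markov μ (fun x => x.1 i) C hC p hp hev
  have h2 := markov μ (fun x => x.2 j) C hC p hp hev
  have : (2 : ℝ) / C ^ p = 1 / C ^ p + 1 / C ^ p := by ring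
  rw [this]
  exact add_le_add h1 h2

lemma T2 {n m p q k : ℕ} (hq : 0 < q) (hk : 0 < k) (hpqk : p = q + k) (hev : Even p)
    {C : ℝ} (hC : 0 < C) (μ : FinDist ((Fin n → ℝ) × (Fin m → ℝ))) (A : Fin n → Fin m → ℝ) :
    ∑ i, ∑ j, μ.exp (fun x => |A i j ^ q * (x.1 i * x.2 j) ^ k -
        A i j ^ q * (truncVal (thrU μ C p i) (x.1 i) * truncVal (thrV μ C p j) (x.2 j)) ^ k|)
      ≤ 2 * (1 / C ^ q * (∑ i, ∑ j, A i j ^ p) ^ ((q : ℝ) / p)) *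
        (∑ i, ∑ j, μ.exp (fun x => (x.1 i * x.2 j) ^ p)) ^ ((k : ℝ) / p) := by
  have hp : 0 < p := by omega
  have hθ : (0 : ℝ) < (q : ℝ) / p := by positivity
  have hφ : (0 : ℝ) < (k : ℝ) / p := by positivity
  have h1 : (q : ℝ) / p + (k : ℝ) / p = 1 := by
    rw [← add_div, hpqk]; push_cast; rw [div_self]; positivity
  have hS : 0 ≤ ∑ i, ∑ j, A i j ^ p :=
    Finset.sum_nonneg fun i _ => Finset.sum_nonneg fun j _ => hev.pow_nonneg _
  obtain ⟨a1, a2, a3⟩ := HB.sum Finset.univ hθ hφ h1 fun i _ =>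
    HB.sum Finset.univ hθ hφ h1 fun j _ => HB.exp μ hθ hφ h1 fun x =>
    tail_pt hp.ne' hev hk.ne' (A i j) (thrU μ C p i) (thrV μ C p j) (x.1 i) (x.2 j)
  refine a3.trans (mul_le_mul_of_nonneg_right ?_ (Real.rpow_nonneg a2 _))
  refine const_bound hp.ne' (by omega) hC hS a1 ?_
  rw [Finset.sum_mul]
  refine Finset.sum_le_sum fun i _ => ?_
  rw [Finset.sum_mul]
  refine Finset.sum_le_sum fun j _ => ?_
  rw [exp_cmul, exp_add]
  exact mul_le_mul_of_nonneg_left (bad_bound hp.ne' hev hC μ i j) (hev.pow_nonneg _)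

lemma T3 {n m N p q k : ℕ} (hq : 0 < q) (hk : 0 < k) (hpqk : p = q + k) (hev : Even p)
    {C : ℝ} (hC : 0 < C) (μ : FinDist ((Fin n → ℝ) × (Fin m → ℝ)))
    (lam : Fin N → ℝ) (μ' : Fin N → FinDist ((Fin n → ℝ) × (Fin m → ℝ)))
    (hl : ∀ t, 0 ≤ lam t) (hl1 : ∑ t, lam t = 1)
    (hmix : ∀ f : (Fin n → ℝ) × (Fin m → ℝ) → ℝ,
          FinDist.exp μ f = ∑ t, lam t * FinDist.exp (μ' t) f)
    (hu : ∀ t, ∑ i, FinDist.exp (μ' t) (fun x => x.1 i ^ p)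
          = ∑ i, FinDist.exp μ (fun x => x.1 i ^ p))
    (hv : ∀ t, ∑ j, FinDist.exp (μ' t) (fun x => x.2 j ^ p)
          = ∑ j, FinDist.exp μ (fun x => x.2 j ^ p))
    (A : Fin n → Fin m → ℝ) :
    ∑ t, lam t * ∑ i, ∑ j, (μ' t).exp (fun x => (μ' t).exp fun y =>
        |A i j ^ q * (x.1 i * y.2 j) ^ k -
        A i j ^ q * (truncVal (thrU μ C p i) (x.1 i) * truncVal (thrV μ C p j) (y.2 j)) ^ k|)
      ≤ 2 * (1 / C ^ q * (∑ i, ∑ j, A i j ^ p) ^ ((q : ℝ) / p)) *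
        ((∑ i, μ.exp (fun x => x.1 i ^ p)) * (∑ j, μ.exp (fun x => x.2 j ^ p)))
          ^ ((k : ℝ) / p) := by
  have hp : 0 < p := by omega
  have hθ : (0 : ℝ) < (q : ℝ) / p := by positivity
  have hφ : (0 : ℝ) < (k : ℝ) / p := by positivity
  have h1 : (q : ℝ) / p + (k : ℝ) / p = 1 := by
    rw [← add_div, hpqk]; push_cast; rw [div_self]; positivity
  have hS : 0 ≤ ∑ i, ∑ j, A i j ^ p :=
    Finset.sum_nonneg fun i _ => Finset.sum_nonneg fun j _ => hev.pow_nonneg _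
  obtain ⟨a1, a2, a3⟩ := HB.sum Finset.univ hθ hφ h1 fun t _ => HB.smul h1 (hl t) <|
    HB.sum Finset.univ hθ hφ h1 fun i _ =>
    HB.sum Finset.univ hθ hφ h1 fun j _ => HB.exp (μ' t) hθ hφ h1 fun x =>
    HB.exp (μ' t) hθ hφ h1 fun y =>
    tail_pt hp.ne' hev hk.ne' (A i j) (thrU μ C p i) (thrV μ C p j) (x.1 i) (y.2 j)
  have e2 : ∑ t, lam t * ∑ i, ∑ j, (μ' t).exp (fun x => (μ' t).exp fun y => (x.1 i * y.2 j) ^ p)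
      = (∑ i, μ.exp (fun x => x.1 i ^ p)) * (∑ j, μ.exp (fun x => x.2 j ^ p)) := by
    have : ∀ t, ∑ i, ∑ j, (μ' t).exp (fun x => (μ' t).exp fun y => (x.1 i * y.2 j) ^ p)
        = (∑ i, μ.exp (fun x => x.1 i ^ p)) * (∑ j, μ.exp (fun x => x.2 j ^ p)) := by
      intro t
      rw [← hu t, ← hv t, Finset.sum_mul_sum]
      simp only [mul_pow, exp_cmul, exp_mulc]
    simp only [this, ← Finset.sum_mul, hl1, one_mul]
  rw [e2] at a3 a2
  refine a3.trans (mul_le_mul_of_nonneg_right ?_ (Real.rpow_nonneg a2 _))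
  refine const_bound hp.ne' (by omega) hC hS a1 ?_
  have e3 : ∑ t, lam t * ∑ i, ∑ j, (μ' t).exp (fun x => (μ' t).exp fun y =>
      A i j ^ p * (bdI (thrU μ C p i) (x.1 i) + bdI (thrV μ C p j) (y.2 j)))
      = ∑ i, ∑ j, A i j ^ p * (μ.exp (fun x => bdI (thrU μ C p i) (x.1 i)) +
        μ.exp (fun x => bdI (thrV μ C p j) (x.2 j))) := by
    simp only [exp_cmul, exp_add, exp_const]
    simp only [hmix (fun x => bdI _ (x.1 _)), hmix (fun x => bdI _ (x.2 _)), Finset.mul_sum,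
      ← Finset.sum_add_distrib]
    rw [Finset.sum_comm]
    refine Finset.sum_congr rfl fun i _ => ?_
    rw [Finset.sum_comm]
    refine Finset.sum_congr rfl fun j _ => Finset.sum_congr rfl fun t _ => by ring
  rw [e3, Finset.sum_mul]
  refine Finset.sum_le_sum fun i _ => ?_
  rw [Finset.sum_mul]
  refine Finset.sum_le_sum fun j _ => ?_
  exact mul_le_mul_of_nonneg_left (bad_bound hp.ne' hev hC μ i j) (hev.pow_nonneg _)

lemma abs_step {n m N : ℕ} (lam : Fin N → ℝ) (hl : ∀ t, 0 ≤ lam t)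
    (D E R : Fin N → Fin n → Fin m → ℝ) (h : ∀ t i j, |D t i j - E t i j| ≤ R t i j) :
    |∑ t, lam t * ((∑ i, ∑ j, D t i j) - ∑ i, ∑ j, E t i j)|
      ≤ ∑ t, lam t * ∑ i, ∑ j, R t i j := by
  refine (Finset.abs_sum_le_sum_abs _ _).trans (Finset.sum_le_sum fun t _ => ?_)
  rw [abs_mul, abs_of_nonneg (hl t)]
  refine mul_le_mul_of_nonneg_left ?_ (hl t)
  rw [← Finset.sum_sub_distrib]
  simp only [← Finset.sum_sub_distrib]
  refine (Finset.abs_sum_le_sum_abs _ _).trans (Finset.sum_le_sum fun i _ => ?_)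
  refine (Finset.abs_sum_le_sum_abs _ _).trans (Finset.sum_le_sum fun j _ => ?_)
  exact h t i j

/-- rounding error for the polynomial-growth part of the ℓ_p LRA
objective under an approximate pairwise independence (total variation)
assumption on the truncated variables. -/
theorem stmt_15 :
    ∃ C₀ : ℝ, 1 ≤ C₀ ∧
      ∀ (n m : ℕ), 1 ≤ n → 1 ≤ m →
      ∀ (p q : ℕ), 2 ≤ p → Even p → 1 ≤ q → q ≤ p - 1 →
      ∀ (ε C : ℝ), 0 < ε → ε ≤ 1 → 0 < C →
      ∀ (N : ℕ) (μ : FinDist ((Fin n → ℝ) × (Fin m → ℝ)))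
        (lam : Fin N → ℝ) (μ' : Fin N → FinDist ((Fin n → ℝ) × (Fin m → ℝ))),
        (∀ t, 0 ≤ lam t) → (∑ t, lam t = 1) →
        (∀ f : (Fin n → ℝ) × (Fin m → ℝ) → ℝ,
          FinDist.exp μ f = ∑ t, lam t * FinDist.exp (μ' t) f) →
        (∀ t, ∑ i, FinDist.exp (μ' t) (fun x => x.1 i ^ p)
          = ∑ i, FinDist.exp μ (fun x => x.1 i ^ p)) →
        (∀ t, ∑ j, FinDist.exp (μ' t) (fun x => x.2 j ^ p)
          = ∑ j, FinDist.exp μ (fun x => x.2 j ^ p)) →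
      ∀ A : Fin n → Fin m → ℝ,
        (∑ t, lam t * ∑ i, (∑ j, A i j ^ p) *
            (∑ j, tvJoint (μ' t)
                (fun x => truncVal (thrU μ C p i) (x.1 i))
                (fun x => truncVal (thrV μ C p j) (x.2 j))
                  ^ ((p : ℝ) / ((p : ℝ) - (q : ℝ)))
              * FinDist.exp μ (fun x => x.2 j ^ p))
                ^ (((p : ℝ) - (q : ℝ)) / (q : ℝ))
          ≤ ε * (∑ i, ∑ j, A i j ^ p) ^ (((p : ℝ) + (q : ℝ)) / (2 * (q : ℝ)))) →
        |∑ t, lam t *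
            ((∑ i, ∑ j, FinDist.exp (μ' t)
                (fun x => A i j ^ q * (x.1 i * x.2 j) ^ (p - q)))
              - (∑ i, ∑ j, prodExp2 (μ' t) (fun x => x.1 i) (fun x => x.2 j)
                  (fun a b => A i j ^ q * (a * b) ^ (p - q))))|
          ≤ C₀ * (C ^ (2 * (p - q)) * ε ^ ((q : ℝ) / (p : ℝ))
                * (∑ i, FinDist.exp μ (fun x => x.1 i ^ p))
                    ^ (((p : ℝ) - (q : ℝ)) / (p : ℝ))
                * (∑ i, ∑ j, A i j ^ p) ^ (((p : ℝ) + (q : ℝ)) / (2 * (p : ℝ)))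
              + (1 / C ^ q) * (∑ i, ∑ j, A i j ^ p) ^ ((q : ℝ) / (p : ℝ))
                * ((∑ i, ∑ j, FinDist.exp μ (fun x => (x.1 i * x.2 j) ^ p))
                      ^ (((p : ℝ) - (q : ℝ)) / (p : ℝ))
                  + ((∑ i, FinDist.exp μ (fun x => x.1 i ^ p))
                      * (∑ j, FinDist.exp μ (fun x => x.2 j ^ p)))
                        ^ (((p : ℝ) - (q : ℝ)) / (p : ℝ)))) := by
  refine ⟨2, by norm_num, ?_⟩
  intro n m _ _ p q hp2 hev hq hqp ε C hε _ hC N μ lam μ' hl hl1 hmix hu hv A h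
  obtain ⟨k, hkdef⟩ : ∃ k, k = p - q := ⟨_, rfl⟩
  have hpqk : p = q + k := by omega
  have hk : 0 < k := by omega
  have hp : p ≠ 0 := by omega
  have hcast : (p : ℝ) - (q : ℝ) = k := by rw [hpqk]; push_cast; ring
  rw [hcast] at h ⊢
  rw [← hkdef]
  have hUn : ∀ i, 0 ≤ μ.exp (fun x => x.1 i ^ p) := fun i => exp_nonneg' μ fun x => hev.pow_nonneg _
  have hVn : ∀ j, 0 ≤ μ.exp (fun x => x.2 j ^ p) := fun j => exp_nonneg' μ fun x => hev.pow_nonneg _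
  have t1 := T1 hq hk hpqk hev hε lam hl hl1 A _ (fun t i j => tv_nonneg _ _ _)
    (fun i => μ.exp (fun x => x.1 i ^ p)) (fun j => μ.exp (fun x => x.2 j ^ p)) hUn hVn h
  have t2 := T2 hq hk hpqk hev hC μ A
  have t3 := T3 hq hk hpqk hev hC μ lam μ' hl hl1 hmix hu hv A
  have hthr : ∀ U : ℝ, 0 ≤ U → (C * U ^ ((1 : ℝ) / (p : ℝ))) ^ k = C ^ k * U ^ ((k : ℝ) / p) := by
    intro U hU
    rw [mul_pow, ← Real.rpow_natCast (U ^ _), ← Real.rpow_mul hU]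
    congr 2; ring
  -- pointwise decomposition
  have dec : ∀ t i j, |(μ' t).exp (fun x => A i j ^ q * (x.1 i * x.2 j) ^ k)
      - prodExp2 (μ' t) (fun x => x.1 i) (fun x => x.2 j) (fun a b => A i j ^ q * (a * b) ^ k)|
      ≤ 2 * C ^ (2 * k) * (|A i j| ^ q * (tvJoint (μ' t)
                (fun x => truncVal (thrU μ C p i) (x.1 i))
                (fun x => truncVal (thrV μ C p j) (x.2 j)) *
          (μ.exp (fun x => x.1 i ^ p) ^ ((k : ℝ) / p) * μ.exp (fun x => x.2 j ^ p) ^ ((k : ℝ) / p))))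
        + (μ' t).exp (fun x => |A i j ^ q * (x.1 i * x.2 j) ^ k -
        A i j ^ q * (truncVal (thrU μ C p i) (x.1 i) * truncVal (thrV μ C p j) (x.2 j)) ^ k|)
        + (μ' t).exp (fun x => (μ' t).exp fun y =>
        |A i j ^ q * (x.1 i * y.2 j) ^ k -
        A i j ^ q * (truncVal (thrU μ C p i) (x.1 i) * truncVal (thrV μ C p j) (y.2 j)) ^ k|) := by
    intro t i j
    have hsU : 0 ≤ thrU μ C p i := mul_nonneg hC.le (Real.rpow_nonneg (hUn i) _)
    have hsV : 0 ≤ thrV μ C p j := mul_nonneg hC.le (Real.rpow_nonneg (hVn j) _)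
    have b1 := tv_bound (μ' t) (fun x => truncVal (thrU μ C p i) (x.1 i))
      (fun x => truncVal (thrV μ C p j) (x.2 j)) (fun a b => A i j ^ q * (a * b) ^ k)
      (|A i j| ^ q * ((thrU μ C p i) ^ k * (thrV μ C p j) ^ k)) (by
        intro x y
        rw [abs_mul, abs_pow, abs_pow, abs_mul, mul_pow]
        have := trunc_pt (a := x.1 i) hsU
        have := trunc_pt (a := y.2 j) hsV
        gcongr)
    rw [thrU, thrV, hthr _ (hUn i), hthr _ (hVn j), ← thrU, ← thrV] at b1
    have b2 := exp_abs (μ' t) (fun x => A i j ^ q * (x.1 i * x.2 j) ^ k -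
        A i j ^ q * (truncVal (thrU μ C p i) (x.1 i) * truncVal (thrV μ C p j) (x.2 j)) ^ k)
    have b3 := (exp_abs (μ' t) (fun x => (μ' t).exp fun y => A i j ^ q * (x.1 i * y.2 j) ^ k -
        A i j ^ q * (truncVal (thrU μ C p i) (x.1 i) * truncVal (thrV μ C p j) (y.2 j)) ^ k)).trans
        (exp_mono _ fun x => exp_abs (μ' t) _)
    simp only [exp_sub] at b2 b3
    simp only [prodExp2_eq] at b1 ⊢
    rw [abs_le] at b1 b2 b3 ⊢
    have e : ∀ a w x y z : ℝ, 2 * w * (a * (C ^ k * x * (C ^ k * y)))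
      = 2 * C ^ (2 * k) * (a * (w * (x * y))) := by intros; ring
    rw [e _ _ _ _ 0] at b1
    constructor <;> linarith [b1.1, b1.2, b2.1, b2.2, b3.1, b3.2]
  refine (abs_step lam hl _ _ _ dec).trans ?_
  have e2 : ∑ i, ∑ j, μ.exp (fun x => |A i j ^ q * (x.1 i * x.2 j) ^ k -
        A i j ^ q * (truncVal (thrU μ C p i) (x.1 i) * truncVal (thrV μ C p j) (x.2 j)) ^ k|)
      = ∑ t, lam t * ∑ i, ∑ j, (μ' t).exp (fun x => |A i j ^ q * (x.1 i * x.2 j) ^ k -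
        A i j ^ q * (truncVal (thrU μ C p i) (x.1 i) * truncVal (thrV μ C p j) (x.2 j)) ^ k|) := by
    rw [Finset.sum_congr rfl fun i _ => Finset.sum_congr rfl fun j _ => hmix _]
    simp only [Finset.mul_sum]
    rw [Finset.sum_comm]
    refine (Finset.sum_congr rfl fun j _ => Finset.sum_comm).trans ?_
    rw [Finset.sum_comm]
    exact Finset.sum_congr rfl fun t _ => Finset.sum_comm
  rw [e2] at t2
  simp only [Finset.sum_add_distrib, mul_add, ← Finset.mul_sum, mul_left_comm _ (2 * C ^ (2 * k))]
  have t1' := mul_le_mul_of_nonneg_left t1 (by positivity : 0 ≤ 2 * C ^ (2 * k))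
  refine (add_le_add (add_le_add t1' t2) t3).trans (le_of_eq (by ring))
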